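/- Let p ≥ 1 and let {h, e, f} be a graded sl₂-triple with e ∈ I_{p,p} = Mat_{p,p}(F) ⊕ Mat_{p,p}(F) nilpotent. Then 2p² < tr(2 − h)|_{I_{p,p}^f} ≤ 4p². -/

import Mathlib

open Matrix

/-- The space `I_{p,p}` of block-antidiagonal matrices in `gl_{2p}(F)`
(for the partition `(p, p)`), as a submodule of the matrix space. -/
def antiDiagBlock (F : Type*) [Field F] (p q : ℕ) :
    Submodule F (Matrix (Fin p ⊕ Fin q) (Fin p ⊕ Fin q) F) where
  carrier := {m | (∀ i j, m (Sum.inl i) (Sum.inl j) = 0) ∧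
    ∀ i j, m (Sum.inr i) (Sum.inr j) = 0}
  add_mem' := by
    rintro a b ⟨ha1, ha2⟩ ⟨hb1, hb2⟩
    exact ⟨fun i j => by simp [Matrix.add_apply, ha1 i j, hb1 i j],
           fun i j => by simp [Matrix.add_apply, ha2 i j, hb2 i j]⟩
  zero_mem' := ⟨fun i j => rfl, fun i j => rfl⟩
  smul_mem' := by
    rintro c a ⟨ha1, ha2⟩
    exact ⟨fun i j => by simp [Matrix.smul_apply, ha1 i j],
           fun i j => by simp [Matrix.smul_apply, ha2 i j]⟩

/-- The adjoint action `ad(A) = [A, ·]` on the matrix space. -/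
def matAd (F : Type*) [Field F] {n : Type*} [Fintype n] [DecidableEq n]
    (A : Matrix n n F) : Module.End F (Matrix n n F) :=
  LinearMap.mulLeft F A - LinearMap.mulRight F A

namespace Sl2Aux

set_option linter.unusedSectionVars false

/-- pointwise sl2 relations -/
structure Tri {K W : Type*} [Field K] [AddCommGroup W] [Module K W]
    (E H G : Module.End K W) : Prop where
  hE : ∀ x, H (E x) = E (H x) + (2 : K) • E x
  hG : ∀ x, H (G x) = G (H x) - (2 : K) • G x
  hEG : ∀ x, E (G x) = G (E x) + H x

section
variable {K W : Type*} [Field K] [CharZero K] [AddCommGroup W] [Module K W]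
  {E H G : Module.End K W}

lemma Tri.symm (t : Tri E H G) : Tri G (-H) E where
  hE x := by simp [t.hG]; abel
  hG x := by simp [t.hE]; abel
  hEG x := by simp [t.hEG]

lemma Tri.H_Epow (t : Tri E H G) {w : ℤ} {x : W} (hx : H x = (w : K) • x) (k : ℕ) :
    H ((E ^ k) x) = ((w + 2 * k : ℤ) : K) • (E ^ k) x := by
  induction k with
  | zero => simpa using hx
  | succ k ih =>
    rw [pow_succ', Module.End.mul_apply, t.hE, ih, map_smul, ← add_smul]
    push_cast; congr 1; ring

lemma Tri.H_Gpow (t : Tri E H G) (k : ℕ) (x : W) :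
    H ((G ^ k) x) = (G ^ k) (H x) - (2 * k : K) • (G ^ k) x := by
  induction k with
  | zero => simp
  | succ k ih =>
    simp only [pow_succ', Module.End.mul_apply]
    rw [t.hG, ih, map_sub, map_smul]
    push_cast; module

lemma exists_last {A : Module.End K W} (hA : IsNilpotent A) {x : W} (hx : x ≠ 0) :
    ∃ k : ℕ, (A ^ k) x ≠ 0 ∧ (A ^ (k + 1)) x = 0 := by
  classical
  have h : ∃ n, (A ^ n) x = 0 := by
    obtain ⟨n, hn⟩ := hA
    exact ⟨n, by simp [hn]⟩
  have h0 : Nat.find h ≠ 0 := by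
    intro h0
    have := Nat.find_spec h
    rw [h0] at this
    exact hx (by simpa using this)
  obtain ⟨k, hk⟩ := Nat.exists_eq_succ_of_ne_zero h0
  refine ⟨k, Nat.find_min h (by omega), ?_⟩
  have := Nat.find_spec h
  rwa [hk] at this

lemma Tri.eg_inj (t : Tri E H G) (hnil : IsNilpotent E) {w : ℤ} (hw : 1 ≤ w) {x : W}
    (hx : H x = (w : K) • x) (h0 : E (G x) = 0) : x = 0 := by
  by_contra hne
  have key : ∀ k : ℕ, G ((E ^ (k + 1)) x) = ((-((k + 1) * (w + k)) : ℤ) : K) • (E ^ k) x := by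
    intro k
    induction k with
    | zero =>
      have := t.hEG x
      rw [h0, hx] at this
      simp only [zero_add, pow_one, pow_zero, Module.End.one_apply]
      rw [eq_neg_of_add_eq_zero_left this.symm, ← neg_smul]
      push_cast; congr 1; ring
    | succ k ih =>
      have := t.hEG ((E ^ (k + 1)) x)
      rw [ih, t.H_Epow hx, map_smul] at this
      rw [pow_succ' E (k + 1), Module.End.mul_apply, eq_sub_of_add_eq this.symm,
        ← Module.End.mul_apply, ← pow_succ', ← sub_smul]
      push_cast; congr 1; ring
  obtain ⟨k, hk, hk1⟩ := exists_last hnil hne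
  have := key k
  rw [hk1, map_zero] at this
  rcases smul_eq_zero.mp this.symm with h | h
  · have h' : -(((k : ℤ) + 1) * (w + k)) = 0 := by exact_mod_cast h
    have : 0 < ((k : ℤ) + 1) * (w + k) := by positivity
    omega
  · exact hk h

lemma Tri.E_Gpow (t : Tri E H G) (n : ℕ) (x : W) :
    E ((G ^ (n + 1)) x) = (G ^ (n + 1)) (E x) + ((n : K) + 1) • (G ^ n) (H x - (n : K) • x) := by
  induction n generalizing x with
  | zero => simp [t.hEG]
  | succ n ih =>
    have h1 : (G ^ (n + 1 + 1)) x = (G ^ (n + 1)) (G x) := by rw [pow_succ, Module.End.mul_apply]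
    have h2 : ∀ y, (G ^ (n + 1 + 1)) y = (G ^ (n + 1)) (G y) := fun y => by
      rw [pow_succ, Module.End.mul_apply]
    have h3 : ∀ y, (G ^ (n + 1)) y = (G ^ n) (G y) := fun y => by
      rw [pow_succ, Module.End.mul_apply]
    rw [h1, ih, t.hEG, t.hG, h2]
    simp only [map_add, map_sub, map_smul, h3]
    push_cast
    module

lemma Tri.ker_semi (t : Tri E H G) (hG : IsNilpotent G) {w : K} {x : W} (hx : E x = 0)
    (h2 : H (H x - w • x) = w • (H x - w • x)) : H x - w • x = 0 := by
  set y := H x - w • x with hy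
  by_contra hne
  have hEy : E y = 0 := by
    have := t.hE x
    rw [hx] at this
    simp at this
    simp [hy, hx, ← this]
  have hHx : H x = y + w • x := by simp [hy]
  obtain ⟨n, hn, hn1⟩ := exists_last hG hne
  have hx0 : x ≠ 0 := by rintro rfl; simp [hy] at hne
  obtain ⟨m, hm, hm1⟩ := exists_last hG hx0
  have e1 := t.E_Gpow n y
  rw [hn1, hEy, h2, ← sub_smul, map_zero, map_zero, zero_add, map_smul, smul_smul] at e1
  have ncast : ∀ n : ℕ, (n : K) + 1 ≠ 0 := fun n => by exact_mod_cast Nat.succ_ne_zero n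
  have wn : w = n := by
    rcases smul_eq_zero.mp e1.symm with h | h
    · rcases mul_eq_zero.mp h with h | h
      · exact absurd h (ncast n)
      · exact sub_eq_zero.mp h
    · exact absurd h hn
  have hym : (G ^ (m + 1)) y = 0 := by
    have := t.H_Gpow (m + 1) x
    rw [hm1, map_zero] at this
    have h3 : (G ^ (m + 1)) (H x) = 0 := by
      simpa using this.symm
    simp [hy, h3, hm1]
  have hnm : n ≤ m := by
    by_contra hlt
    apply hn
    have : n = (n - (m + 1)) + (m + 1) := by omega
    rw [this, pow_add, Module.End.mul_apply, hym, map_zero]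
  have e2 := t.E_Gpow m x
  rw [hm1, hx, map_zero, map_zero, zero_add, hHx] at e2
  have e3 := (smul_eq_zero.mp e2.symm).resolve_left (ncast m)
  rcases hnm.eq_or_lt with rfl | hlt
  · apply hn
    simpa [wn] using e3
  · have hy0 : (G ^ m) y = 0 := by
      have : m = (m - (n + 1)) + (n + 1) := by omega
      rw [this, pow_add, Module.End.mul_apply, hn1, map_zero]
    rw [map_sub, map_add, map_smul, map_smul, hy0, zero_add, ← sub_smul] at e3
    have := (smul_eq_zero.mp e3).resolve_right hm
    rw [wn, sub_eq_zero] at this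
    have : n = m := by exact_mod_cast this
    omega

variable [FiniteDimensional K W]

lemma Tri.eg_surj (t : Tri E H G) (hnil : IsNilpotent E) {w : ℤ} (hw : 1 ≤ w) {x : W}
    (hx : H x = (w : K) • x) : ∃ z, H z = (w : K) • z ∧ E (G z) = x := by
  have hmap : ∀ z ∈ Module.End.eigenspace H (w : K), (E * G) z ∈ Module.End.eigenspace H (w : K) := by
    intro z hz
    rw [Module.End.mem_eigenspace_iff] at hz ⊢
    rw [Module.End.mul_apply, t.hE, t.hG, hz]
    simp
  let A := (E * G).restrict hmap
  have inj : Function.Injective A := by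
    rw [← LinearMap.ker_eq_bot, LinearMap.ker_eq_bot']
    rintro ⟨z, hz⟩ h
    have h' : E (G z) = 0 := congrArg Subtype.val h
    ext
    exact t.eg_inj hnil hw (Module.End.mem_eigenspace_iff.mp hz) h'
  obtain ⟨⟨z, hz⟩, h⟩ := LinearMap.injective_iff_surjective.mp inj
    ⟨x, Module.End.mem_eigenspace_iff.mpr hx⟩
  exact ⟨z, Module.End.mem_eigenspace_iff.mp hz, congrArg Subtype.val h⟩

lemma Tri.semi_nonneg (t : Tri E H G) (hE : IsNilpotent E) (hG : IsNilpotent G) (k : ℕ) :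
    ∀ {w : ℤ}, 0 ≤ w → ∀ {x : W}, (E ^ k) x = 0 →
    H (H x - (w : K) • x) = (w : K) • (H x - (w : K) • x) → H x - (w : K) • x = 0 := by
  induction k with
  | zero => intro w _ x hx _; have : x = 0 := by simpa using hx
            simp [this]
  | succ k ih =>
    intro w hw x hx h2
    have e1 : H (E x) - ((w + 2 : ℤ) : K) • E x = E (H x - (w : K) • x) := by
      rw [t.hE, map_sub, map_smul]; push_cast; module
    have e2 : H (E x) - ((w + 2 : ℤ) : K) • E x = 0 := by
      apply ih (by omega)
      · rwa [← Module.End.mul_apply, ← pow_succ]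
      · rw [e1, t.hE, h2, map_smul]; push_cast; module
    obtain ⟨z, hz, hz'⟩ := t.eg_surj hE (w := w + 2) (by omega) (sub_eq_zero.mp e2)
    have hGz : H (G z) = (w : K) • G z := by
      rw [t.hG, hz, map_smul]; push_cast; module
    have e3 : H (x - G z) - (w : K) • (x - G z) = H x - (w : K) • x := by
      rw [map_sub, hGz]; module
    rw [← e3]
    apply t.ker_semi hG
    · simp [hz']
    · rw [e3, h2]

lemma Tri.semi (t : Tri E H G) (hE : IsNilpotent E) (hG : IsNilpotent G) {w : ℤ} {x : W}
    (h2 : H (H x - (w : K) • x) = (w : K) • (H x - (w : K) • x)) : H x - (w : K) • x = 0 := by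
  rcases le_total 0 w with hw | hw
  · obtain ⟨k, hk⟩ := id hE
    exact t.semi_nonneg hE hG k hw (by simp [hk]) h2
  · obtain ⟨k, hk⟩ := id hG
    have e : (-H) x - ((-w : ℤ) : K) • x = -(H x - (w : K) • x) := by
      simp; abel
    have := t.symm.semi_nonneg hG hE k (w := -w) (by omega) (x := x) (by simp [hk])
      (by rw [e]; simp only [map_neg, LinearMap.neg_apply, h2]; push_cast; module)
    rw [e] at this
    exact neg_eq_zero.mp this

/-- killed by a product of `H - k`, `k` integers -/
inductive Good (H : Module.End K W) : W → Prop
  | zero : Good H 0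
  | step (k : ℤ) (x : W) : Good H (H x - (k : K) • x) → Good H x

lemma Tri.good_ker (t : Tri E H G) (n : ℕ) : ∀ {x : W}, E x = 0 → (G ^ n) x = 0 → Good H x := by
  induction n with
  | zero => intro x _ hx; have : x = 0 := by simpa using hx
            rw [this]; exact Good.zero
  | succ n ih =>
    intro x h0 hx
    have e := t.E_Gpow n x
    rw [hx, h0, map_zero, map_zero, zero_add] at e
    have ncast : (n : K) + 1 ≠ 0 := by exact_mod_cast Nat.succ_ne_zero n
    have e3 := (smul_eq_zero.mp e.symm).resolve_left ncast
    apply Good.step (n : ℤ)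
    apply ih
    · have := t.hE x
      rw [h0] at this
      simp at this
      simp [h0, ← this]
    · simpa using e3

lemma Tri.good_of_E (t : Tri E H G) (hG : IsNilpotent G) {y : W} (hy : Good H y) :
    ∀ x, E x = y → Good H x := by
  induction hy with
  | zero => intro x hx
            obtain ⟨n, hn⟩ := hG
            exact t.good_ker n hx (by simp [hn])
  | step k y _ ih =>
    rintro x rfl
    apply Good.step (k - 2)
    apply ih
    rw [t.hE, map_sub, map_smul]; push_cast; module

lemma Tri.good (t : Tri E H G) (hE : IsNilpotent E) (hG : IsNilpotent G) (x : W) : Good H x := by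
  obtain ⟨n, hn⟩ := hE
  have : ∀ k : ℕ, ∀ x, (E ^ k) x = 0 → Good H x := by
    intro k
    induction k with
    | zero => intro x hx; have : x = 0 := by simpa using hx
              rw [this]; exact Good.zero
    | succ k ih =>
      intro x hx
      exact t.good_of_E hG (ih (E x) (by rwa [← Module.End.mul_apply, ← pow_succ])) x rfl
  exact this n x (by simp [hn])

lemma Tri.span_eig (t : Tri E H G) (hE : IsNilpotent E) (hG : IsNilpotent G) :
    Submodule.span K {x : W | ∃ k : ℤ, H x = (k : K) • x} = ⊤ := by
  set S := Submodule.span K {x : W | ∃ k : ℤ, H x = (k : K) • x} with hS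
  rw [eq_top_iff]
  rintro x -
  induction t.good hE hG x with
  | zero => exact S.zero_mem
  | step a x _ ih =>
    have key : ∀ y ∈ S, ∃ z ∈ S, H (y - (H z - (a : K) • z)) = (a : K) • (y - (H z - (a : K) • z)) := by
      intro y hy
      induction hy using Submodule.span_induction with
      | mem y hy =>
        obtain ⟨k, hk⟩ := id hy
        by_cases hka : k = a
        · exact ⟨0, S.zero_mem, by simp [hk, hka]⟩
        · have : (k : K) - a ≠ 0 := by
            rw [sub_ne_zero]; exact_mod_cast hka
          refine ⟨((k : K) - a)⁻¹ • y, S.smul_mem _ (Submodule.subset_span hy), ?_⟩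
          have : y - (H (((k : K) - a)⁻¹ • y) - (a : K) • ((k : K) - a)⁻¹ • y) = 0 := by
            rw [map_smul, hk, smul_smul, smul_smul, ← sub_smul, sub_eq_zero]
            have : ((k : K) - a)⁻¹ * k - a * ((k : K) - a)⁻¹ = 1 := by
              field_simp
            rw [this, one_smul]
          rw [this]; simp
      | zero => exact ⟨0, S.zero_mem, by simp⟩
      | add y1 y2 _ _ h1 h2 =>
        obtain ⟨z1, m1, h1⟩ := h1
        obtain ⟨z2, m2, h2⟩ := h2
        refine ⟨z1 + z2, S.add_mem m1 m2, ?_⟩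
        have : y1 + y2 - (H (z1 + z2) - (a : K) • (z1 + z2)) =
          (y1 - (H z1 - (a : K) • z1)) + (y2 - (H z2 - (a : K) • z2)) := by
            rw [map_add]; module
        rw [this, map_add, h1, h2, smul_add]
      | smul c y _ h1 =>
        obtain ⟨z1, m1, h1⟩ := h1
        refine ⟨c • z1, S.smul_mem _ m1, ?_⟩
        have : c • y - (H (c • z1) - (a : K) • (c • z1)) = c • (y - (H z1 - (a : K) • z1)) := by
            rw [map_smul]; module
        rw [this, map_smul, h1, smul_comm]
    obtain ⟨z, hz, h⟩ := key _ ih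
    have e : H x - (a : K) • x - (H z - (a : K) • z) = H (x - z) - (a : K) • (x - z) := by
      rw [map_sub]; module
    rw [e] at h
    have := t.semi hE hG h
    have h2 : x - z ∈ S := Submodule.subset_span ⟨a, sub_eq_zero.mp this⟩
    simpa using S.add_mem h2 hz

end
end Sl2Aux

namespace Sl2Aux

section comb
variable {p : ℕ} (u : Fin p ⊕ Fin p → ℤ)

abbrev Odd2 (i j : Fin p ⊕ Fin p) : Prop := i.isLeft ≠ j.isLeft

def kval : ℤ :=
  (∑ i, ∑ j, if Odd2 i j ∧ u i ≤ u j then 2 + u j - u i else 0) -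
  (∑ i, ∑ j, if ¬ Odd2 i j ∧ u i + 2 ≤ u j then u j - u i else 0)

def eps (i : Fin p ⊕ Fin p) : ℤ := if i.isLeft then 1 else -1

lemma sum_eps : ∑ i : Fin p ⊕ Fin p, eps i = 0 := by
  simp [eps, Fintype.sum_sum_type]

lemma abs_eq_sum (B x y : ℤ) (hx : -B ≤ x ∧ x ≤ B) (hy : -B ≤ y ∧ y ≤ B) :
    |x - y| = ∑ t ∈ Finset.Ico (-B) B,
      ((if x ≤ t then (1 : ℤ) else 0) - (if y ≤ t then 1 else 0)) ^ 2 := by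
  wlog h : x ≤ y generalizing x y
  · rw [abs_sub_comm, this y x hy hx (by omega)]
    refine Finset.sum_congr rfl fun t _ => by ring
  have : ∀ t ∈ Finset.Ico (-B) B, ((if x ≤ t then (1 : ℤ) else 0) - (if y ≤ t then 1 else 0)) ^ 2
      = if t ∈ Finset.Ico x y then 1 else 0 := by
    intro t _
    simp only [Finset.mem_Ico]
    split_ifs <;> omega
  rw [Finset.sum_congr rfl this, ← Finset.sum_filter, Finset.sum_const]
  have h2 : Finset.filter (fun t => t ∈ Finset.Ico x y) (Finset.Ico (-B) B) = Finset.Ico x y := by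
    ext t; simp only [Finset.mem_filter, Finset.mem_Ico]; omega
  rw [h2, Int.card_Ico, abs_of_nonpos (by omega)]
  simp; omega

lemma quad {ι : Type*} [Fintype ι] (ε x : ι → ℤ) (h : ∑ i, ε i = 0) :
    ∑ i, ∑ j, ε i * ε j * (x i - x j) ^ 2 = -2 * (∑ i, ε i * x i) ^ 2 := by
  have h1 : ∀ i j, ε i * ε j * (x i - x j) ^ 2 =
    (ε i * x i ^ 2) * ε j - 2 * ((ε i * x i) * (ε j * x j)) + ε i * (ε j * x j ^ 2) := by
      intros; ring
  simp only [h1, Finset.sum_add_distrib, Finset.sum_sub_distrib, ← Finset.mul_sum,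
    ← Finset.sum_mul, h]
  ring

lemma kval_lower (hp : 1 ≤ p) : 2 * (p : ℤ) ^ 2 < kval u := by
  classical
  obtain ⟨B, hB⟩ : ∃ B : ℤ, ∀ i, -B + 1 ≤ u i ∧ u i + 1 ≤ B := by
    refine ⟨∑ i, |u i| + 1, fun i => ?_⟩
    have : |u i| ≤ ∑ i, |u i| := Finset.single_le_sum (f := fun i => |u i|)
      (fun _ _ => abs_nonneg _) (Finset.mem_univ i)
    have := abs_le.mp this
    omega
  set C : ℤ → ℤ := fun t => ∑ i, eps i * (if u i ≤ t then 1 else 0) with hC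
  have hq : ∑ i, ∑ j, eps i * eps j * |u i - u j| = -2 * ∑ t ∈ Finset.Ico (-B) B, C t ^ 2 := by
    have : ∀ i j, eps i * eps j * |u i - u j| = ∑ t ∈ Finset.Ico (-B) B,
      eps i * eps j * ((if u i ≤ t then (1 : ℤ) else 0) - (if u j ≤ t then 1 else 0)) ^ 2 := by
        intro i j
        have := hB i
        have := hB j
        rw [← Finset.mul_sum, ← abs_eq_sum B _ _ ⟨by omega, by omega⟩ ⟨by omega, by omega⟩]
    simp only [this]
    have h2 : ∀ i, ∑ j, ∑ t ∈ Finset.Ico (-B) B,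
      eps i * eps j * ((if u i ≤ t then (1 : ℤ) else 0) - (if u j ≤ t then 1 else 0)) ^ 2
      = ∑ t ∈ Finset.Ico (-B) B, ∑ j,
      eps i * eps j * ((if u i ≤ t then (1 : ℤ) else 0) - (if u j ≤ t then 1 else 0)) ^ 2 :=
        fun i => Finset.sum_comm
    simp only [h2]
    rw [Finset.sum_comm, Finset.mul_sum]
    refine Finset.sum_congr rfl fun t _ => ?_
    exact quad eps (fun i => if u i ≤ t then 1 else 0) sum_eps
  set Z : ℤ := ∑ i, ∑ j, if Odd2 i j ∧ u i = u j then (2 : ℤ) else 0 with hZ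
  -- symmetrised bound
  have hsym : 4 * (p : ℤ) ^ 2 + 2 * ∑ t ∈ Finset.Ico (-B) B, C t ^ 2 + Z ≤ 2 * kval u := by
    set c : Fin p ⊕ Fin p → Fin p ⊕ Fin p → ℤ := fun i j =>
      (if Odd2 i j ∧ u i ≤ u j then 2 + u j - u i else 0) -
      (if ¬ Odd2 i j ∧ u i + 2 ≤ u j then u j - u i else 0) with hc
    have hk : kval u = ∑ i, ∑ j, c i j := by
      simp only [hc, kval, Finset.sum_sub_distrib]
    have hk2 : kval u = ∑ i, ∑ j, c j i := by rw [hk, Finset.sum_comm]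
    have h4 : ∑ i : Fin p ⊕ Fin p, ∑ j : Fin p ⊕ Fin p, (1 - eps i * eps j) = 4 * (p : ℤ) ^ 2 := by
      simp only [Finset.sum_sub_distrib, ← Finset.mul_sum, sum_eps]
      simp; ring
    have : 2 * kval u = ∑ i, ∑ j, (c i j + c j i) := by
      simp only [Finset.sum_add_distrib, ← hk, ← hk2]; ring
    rw [this, ← h4]
    have e : 2 * ∑ t ∈ Finset.Ico (-B) B, C t ^ 2 = -∑ i, ∑ j, eps i * eps j * |u i - u j| := by
      rw [hq]; ring
    rw [e, hZ]
    simp only [← Finset.sum_neg_distrib, ← Finset.sum_add_distrib]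
    refine Finset.sum_le_sum fun i _ => Finset.sum_le_sum fun j _ => ?_
    simp only [hc, eps, Odd2]
    have habs : |u i - u j| = if u i ≤ u j then u j - u i else u i - u j := by
      split_ifs with h
      · rw [abs_of_nonpos (by omega)]; ring
      · rw [abs_of_nonneg (by omega)]
    rw [habs]
    rcases i with i | i <;> rcases j with j | j <;> simp <;> split_ifs <;> omega
  have hCn : 0 ≤ ∑ t ∈ Finset.Ico (-B) B, C t ^ 2 := Finset.sum_nonneg fun _ _ => sq_nonneg _
  have hZn : 0 ≤ Z := Finset.sum_nonneg fun _ _ => Finset.sum_nonneg fun _ _ => by split_ifs <;> norm_num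
  have hpos : 0 < 2 * ∑ t ∈ Finset.Ico (-B) B, C t ^ 2 + Z := by
    by_contra hcon
    have hC0 : ∑ t ∈ Finset.Ico (-B) B, C t ^ 2 = 0 := by omega
    have hZ0 : Z = 0 := by omega
    have hCt : ∀ t ∈ Finset.Ico (-B) B, C t = 0 := fun t ht => by
      have := (Finset.sum_eq_zero_iff_of_nonneg (fun t _ => sq_nonneg (C t))).mp hC0 t ht
      exact pow_eq_zero_iff (two_ne_zero) |>.mp this
    let i0 : Fin p ⊕ Fin p := Sum.inl ⟨0, hp⟩
    have hne : ∀ j, Odd2 i0 j → u i0 ≠ u j := by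
      intro j ho he
      have h1 := (Finset.sum_eq_zero_iff_of_nonneg (fun i _ => Finset.sum_nonneg fun _ _ => by
        split_ifs <;> norm_num)).mp hZ0 i0 (Finset.mem_univ _)
      have h2 := (Finset.sum_eq_zero_iff_of_nonneg (fun i _ => by
        split_ifs <;> norm_num)).mp h1 j (Finset.mem_univ _)
      rw [if_pos ⟨ho, he⟩] at h2
      norm_num at h2
    have hb := hB i0
    have c1 := hCt (u i0) (by rw [Finset.mem_Ico]; omega)
    have c2 := hCt (u i0 - 1) (by rw [Finset.mem_Ico]; omega)
    have c3 : C (u i0) - C (u i0 - 1) = ∑ i, if u i = u i0 then (1 : ℤ) else 0 := by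
      rw [hC]
      simp only [← Finset.sum_sub_distrib]
      refine Finset.sum_congr rfl fun i _ => ?_
      by_cases hi : u i = u i0
      · have : i.isLeft = true := by
          by_contra hl
          exact hne i (by simp [i0, hl]) hi.symm
        simp [eps, this, hi]
      · rw [if_neg hi]
        split_ifs <;> omega
    rw [c1, c2] at c3
    have : (if u i0 = u i0 then (1 : ℤ) else 0) ≤ ∑ i, if u i = u i0 then (1 : ℤ) else 0 :=
      Finset.single_le_sum (f := fun i => if u i = u i0 then (1 : ℤ) else 0)
        (fun _ _ => by split_ifs <;> norm_num) (Finset.mem_univ i0)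
    rw [if_pos rfl] at this
    omega
  linarith

def cnt (o : Prop) [Decidable o] (d : ℤ) : ℤ :=
  ∑ i, ∑ j, if (Odd2 i j ↔ o) ∧ u j - u i = d then 1 else 0

lemma sum_cnt (o : Prop) [Decidable o] (M : ℕ) (hM : ∀ i j, u j - u i < M) (g : ℤ → ℤ) :
    ∑ d ∈ Finset.range M, g d * cnt u o d =
      ∑ i, ∑ j, if (Odd2 i j ↔ o) ∧ u i ≤ u j then g (u j - u i) else 0 := by
  simp only [cnt, Finset.mul_sum]
  rw [Finset.sum_comm]
  refine Finset.sum_congr rfl fun i _ => ?_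
  rw [Finset.sum_comm]
  refine Finset.sum_congr rfl fun j _ => ?_
  by_cases ho : (Odd2 i j ↔ o)
  · by_cases hij : u i ≤ u j
    · rw [if_pos ⟨ho, hij⟩, Finset.sum_eq_single (u j - u i).toNat]
      · have : ((u j - u i).toNat : ℤ) = u j - u i := by omega
        rw [this, if_pos ⟨ho, rfl⟩, mul_one]
      · intro d _ hd
        rw [if_neg (fun h => hd (by omega)), mul_zero]
      · intro h
        have := hM i j
        exact absurd (Finset.mem_range.mpr (by omega)) h
    · rw [if_neg (fun h => hij h.2)]
      refine Finset.sum_eq_zero fun d _ => ?_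
      rw [if_neg (fun h => hij (by omega)), mul_zero]
  · rw [if_neg (fun h => ho h.1)]
    refine Finset.sum_eq_zero fun d _ => ?_
    rw [if_neg (fun h => ho h.1), mul_zero]

lemma cnt_nonneg (o : Prop) [Decidable o] (d : ℤ) : 0 ≤ cnt u o d :=
  Finset.sum_nonneg fun _ _ => Finset.sum_nonneg fun _ _ => by split_ifs <;> norm_num

lemma cnt_neg (o : Prop) [Decidable o] (d : ℤ) : cnt u o (-d) = cnt u o d := by
  unfold cnt
  rw [Finset.sum_comm]
  refine Finset.sum_congr rfl fun i _ => Finset.sum_congr rfl fun j _ => ?_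
  have : ((Odd2 j i ↔ o) ∧ u i - u j = -d) ↔ ((Odd2 i j ↔ o) ∧ u j - u i = d) := by
    rw [Odd2, Odd2, ne_comm]
    refine and_congr_right fun _ => ⟨fun h => by omega, fun h => by omega⟩
  simp only [this]

lemma kval_upper (h1 : ∀ d : ℤ, 1 ≤ d → cnt u True (d + 2) ≤ cnt u False d)
    (h2 : cnt u False 1 ≤ cnt u True (-1)) : kval u ≤ 4 * (p : ℤ) ^ 2 := by
  obtain ⟨N, hN⟩ : ∃ N : ℕ, ∀ i j, u j - u i < N + 1 := by
    refine ⟨(2 * ∑ i, |u i|).toNat, fun i j => ?_⟩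
    have a1 : |u i| ≤ ∑ i, |u i| := Finset.single_le_sum (f := fun i => |u i|)
      (fun _ _ => abs_nonneg _) (Finset.mem_univ i)
    have a2 : |u j| ≤ ∑ i, |u i| := Finset.single_le_sum (f := fun i => |u i|)
      (fun _ _ => abs_nonneg _) (Finset.mem_univ j)
    have := abs_le.mp a1
    have := abs_le.mp a2
    omega
  have ha := sum_cnt u True (N + 4) (fun i j => by have := hN i j; push_cast; omega)
  have hb := sum_cnt u False (N + 2) (fun i j => by have := hN i j; push_cast; omega)
  have hk : kval u = ∑ d ∈ Finset.range (N + 4), (2 + (d : ℤ)) * cnt u True d -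
      ∑ d ∈ Finset.range (N + 2), (if 2 ≤ (d : ℤ) then (d : ℤ) else 0) * cnt u False d := by
    rw [ha (fun d => 2 + d), hb (fun d => if 2 ≤ d then d else 0), kval]
    congr 1
    · refine Finset.sum_congr rfl fun i _ => Finset.sum_congr rfl fun j _ => ?_
      simp only [iff_true]
      split_ifs <;> ring
    · refine Finset.sum_congr rfl fun i _ => Finset.sum_congr rfl fun j _ => ?_
      simp only [iff_false]
      by_cases ho : Odd2 i j
      · simp [ho]
      · simp only [ho, not_false_eq_true, true_and]
        split_ifs <;> omega
  have h4 : 4 * (p : ℤ) ^ 2 =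
      ∑ d ∈ Finset.range (N + 4), (if (d : ℤ) = 0 then 2 else 4) * cnt u True d := by
    rw [ha (fun d => if d = 0 then 2 else 4)]
    set c : Fin p ⊕ Fin p → Fin p ⊕ Fin p → ℤ := fun i j =>
      if (Odd2 i j ↔ True) ∧ u i ≤ u j then (if u j - u i = 0 then 2 else 4) else 0 with hc
    have hs : ∑ i, ∑ j, (c i j + c j i) = 2 * ∑ i, ∑ j, c i j := by
      simp only [Finset.sum_add_distrib]
      rw [Finset.sum_comm (f := fun i j => c j i)]; ring
    have h5 : ∀ i j, c i j + c j i = if Odd2 i j then 4 else 0 := by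
      intro i j
      simp only [hc, iff_true]
      by_cases ho : Odd2 i j
      · have ho' : Odd2 j i := Ne.symm ho
        rw [if_pos ho]
        split_ifs <;> grind
      · have ho' : ¬ Odd2 j i := fun h => ho (Ne.symm h)
        simp [ho, ho']
    simp only [h5] at hs
    have h6 : ∑ i : Fin p ⊕ Fin p, ∑ j : Fin p ⊕ Fin p, (if Odd2 i j then (4 : ℤ) else 0) = 8 * (p : ℤ) ^ 2 := by
      simp [Fintype.sum_sum_type, Odd2]; ring
    rw [h6] at hs
    linarith
  have key : ∀ n : ℕ, ∑ d ∈ Finset.range (n + 4), (if (d : ℤ) = 0 then 0 else (d : ℤ) - 2) * cnt u True d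
      - ∑ d ∈ Finset.range (n + 2), (if 2 ≤ (d : ℤ) then (d : ℤ) else 0) * cnt u False d ≤ 0 := by
    intro n
    induction n with
    | zero =>
      simp only [Finset.sum_range_succ, Finset.sum_range_zero]
      have := h1 1 le_rfl
      rw [cnt_neg] at h2
      norm_num at this ⊢
      linarith
    | succ n ih =>
      rw [show n + 1 + 4 = (n + 4) + 1 from rfl, show n + 1 + 2 = (n + 2) + 1 from rfl,
        Finset.sum_range_succ _ (n + 4), Finset.sum_range_succ _ (n + 2)]
      have := h1 ((n + 2 : ℕ) : ℤ) (by push_cast; omega)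
      have e : ((n + 2 : ℕ) : ℤ) + 2 = ((n + 4 : ℕ) : ℤ) := by push_cast; ring
      rw [e] at this
      rw [if_neg (by omega), if_pos (by omega)]
      have e2 : ((n + 4 : ℕ) : ℤ) - 2 = ((n + 2 : ℕ) : ℤ) := by push_cast; ring
      rw [e2]
      have := mul_le_mul_of_nonneg_left this (show (0 : ℤ) ≤ ((n + 2 : ℕ) : ℤ) by positivity)
      linarith
  have := key N
  have e : ∑ d ∈ Finset.range (N + 4), (if (d : ℤ) = 0 then 0 else (d : ℤ) - 2) * cnt u True d =
    ∑ d ∈ Finset.range (N + 4), (2 + (d : ℤ)) * cnt u True d -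
    ∑ d ∈ Finset.range (N + 4), (if (d : ℤ) = 0 then 2 else 4) * cnt u True d := by
    rw [← Finset.sum_sub_distrib]
    refine Finset.sum_congr rfl fun d _ => ?_
    split_ifs with h
    · rw [h]; ring
    · ring
  rw [h4, hk]
  linarith

end comb
end Sl2Aux
namespace Sl2Aux

set_option linter.unusedSectionVars false

section diag
variable {F : Type*} [Field F] [CharZero F]

lemma trace_exact {K X Y : Type*} [AddCommGroup K] [Module F K] [AddCommGroup X] [Module F X]
    [AddCommGroup Y] [Module F Y] [FiniteDimensional F K] [FiniteDimensional F X]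
    [FiniteDimensional F Y] (ι : K →ₗ[F] X) (φ : X →ₗ[F] Y) (hι : Function.Injective ι)
    (hφ : Function.Surjective φ) (hex : ∀ x, φ x = 0 ↔ x ∈ LinearMap.range ι)
    (T : Module.End F K) (A : Module.End F X) (B : Module.End F Y)
    (hT : ∀ x, ι (T x) = A (ι x)) (hB : ∀ x, φ (A x) = B (φ x)) :
    LinearMap.trace F K T = LinearMap.trace F X A - LinearMap.trace F Y B := by
  obtain ⟨ρ, hρ⟩ := LinearMap.exists_leftInverse_of_injective ι (LinearMap.ker_eq_bot.mpr hι)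
  obtain ⟨σ, hσ⟩ := LinearMap.exists_rightInverse_of_surjective φ (LinearMap.range_eq_top.mpr hφ)
  have hρ' : ∀ x, ρ (ι x) = x := fun x => LinearMap.congr_fun hρ x
  have hσ' : ∀ x, φ (σ x) = x := fun x => LinearMap.congr_fun hσ x
  have hφι : ∀ x, φ (ι x) = 0 := fun x => (hex _).mpr ⟨x, rfl⟩
  let π : X →ₗ[F] K := ρ ∘ₗ (LinearMap.id - σ ∘ₗ φ)
  have hid : ∀ x, ι (π x) + σ (φ x) = x := by
    intro x
    obtain ⟨y, hy⟩ := (hex (x - σ (φ x))).mp (by simp [hσ'])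
    have : π x = y := by
      change ρ (x - σ (φ x)) = y
      rw [← hy, hρ']
    rw [this, hy]; abel
  have hA : A = (A ∘ₗ ι) ∘ₗ π + (A ∘ₗ σ) ∘ₗ φ := by
    ext x
    simp only [LinearMap.add_apply, LinearMap.comp_apply, ← map_add, hid]
  have e1 : π ∘ₗ (A ∘ₗ ι) = T := by
    ext x
    simp only [LinearMap.comp_apply, ← hT]
    simp [π, hφι, hρ']
  have e2 : φ ∘ₗ (A ∘ₗ σ) = B := by
    ext x
    simp only [LinearMap.comp_apply, hB, hσ']
  have : LinearMap.trace F X A = LinearMap.trace F K T + LinearMap.trace F Y B := by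
    conv_lhs => rw [hA]
    rw [map_add, LinearMap.trace_comp_comm', e1, LinearMap.trace_comp_comm', e2]
  rw [this]; ring

variable {n : Type*} [Fintype n] [DecidableEq n]

lemma matAd_apply (A m : Matrix n n F) : matAd F A m = A * m - m * A := rfl

lemma tri_ad {e h f : Matrix n n F} (rel1 : h * e - e * h = (2 : F) • e)
    (rel2 : h * f - f * h = (-2 : F) • f) (rel3 : e * f - f * e = h) :
    Tri (matAd F e) (matAd F h) (matAd F f) where
  hE m := by
    have r : h * e = e * h + (e + e) := by rw [← two_smul F e, ← rel1]; abel
    simp only [matAd_apply, two_smul, mul_sub, sub_mul, ← mul_assoc, r]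
    simp only [mul_assoc, r]
    noncomm_ring
  hG m := by
    have r : h * f = f * h - (f + f) := by
      have : f + f = (2 : F) • f := (two_smul F f).symm
      rw [this, sub_eq_add_neg, ← neg_smul, ← rel2]; abel
    simp only [matAd_apply, two_smul, mul_sub, sub_mul, ← mul_assoc, r]
    simp only [mul_assoc, r]
    noncomm_ring
  hEG m := by
    subst rel3
    simp only [matAd_apply]
    noncomm_ring

lemma matAd_nilp {A : Matrix n n F} (hA : IsNilpotent A) : IsNilpotent (matAd F A) := by
  unfold matAd
  refine Commute.isNilpotent_sub (LinearMap.commute_mulLeft_right A A) ?_ ?_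
  · rwa [LinearMap.isNilpotent_mulLeft_iff]
  · rwa [LinearMap.isNilpotent_mulRight_iff]

/-- matrices supported on `R` -/
def supp (F : Type*) [Field F] {n : Type*} (R : n → n → Prop) : Submodule F (Matrix n n F) where
  carrier := {m | ∀ i j, ¬ R i j → m i j = 0}
  add_mem' := by
    intro a b ha hb i j h
    simp [ha i j h, hb i j h]
  zero_mem' := fun _ _ _ => rfl
  smul_mem' := by
    intro c a ha i j h
    simp [ha i j h]

noncomputable def suppEquiv (R : n → n → Prop) [∀ i j, Decidable (R i j)] :
    supp F R ≃ₗ[F] ({x : n × n // R x.1 x.2} → F) where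
  toFun m x := m.1 x.1.1 x.1.2
  invFun c := ⟨Matrix.of fun i j => if h : R i j then c ⟨(i, j), h⟩ else 0, fun i j h => by simp [h]⟩
  map_add' _ _ := rfl
  map_smul' _ _ := rfl
  left_inv m := by
    ext i j
    by_cases h : R i j
    · simp [h]
    · simp [h, m.2 i j h]
  right_inv c := by
    ext ⟨⟨i, j⟩, h⟩
    simp [show R i j from h]

lemma finrank_supp (R : n → n → Prop) [∀ i j, Decidable (R i j)] :
    (Module.finrank F (supp F R) : ℤ) = ∑ i, ∑ j, if R i j then 1 else 0 := by
  rw [(suppEquiv R).finrank_eq, Module.finrank_fintype_fun_eq_card, Fintype.card_subtype,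
    ← Fintype.sum_prod_type', Finset.card_filter]
  push_cast
  rfl

lemma trace_supp (R : n → n → Prop) [∀ i j, Decidable (R i j)] (A : Module.End F (supp F R))
    (c : n → n → ℤ) (hA : ∀ m i j, (A m).1 i j = (c i j : F) * m.1 i j) :
    LinearMap.trace F _ A = ((∑ i, ∑ j, if R i j then c i j else 0 : ℤ) : F) := by
  rw [LinearMap.trace_eq_matrix_trace F (Module.Basis.ofEquivFun (suppEquiv R)), Matrix.trace]
  have : ∀ x : {x : n × n // R x.1 x.2},
      (LinearMap.toMatrix (Module.Basis.ofEquivFun (suppEquiv R))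
        (Module.Basis.ofEquivFun (suppEquiv R)) A).diag x = (c x.1.1 x.1.2 : F) := by
    intro x
    rw [Matrix.diag_apply, LinearMap.toMatrix_apply, Module.Basis.ofEquivFun_repr_apply]
    have h1 : suppEquiv R (A (Module.Basis.ofEquivFun (suppEquiv (F := F) R) x)) x
      = (c x.1.1 x.1.2 : F) *
        suppEquiv R (Module.Basis.ofEquivFun (suppEquiv (F := F) R) x) x := hA _ _ _
    rw [h1, Module.Basis.coe_ofEquivFun]
    simp
  rw [Finset.sum_congr rfl (fun x _ => this x)]
  rw [← Fintype.sum_prod_type' (f := fun i j => if R i j then c i j else 0), ← Finset.sum_filter,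
    Finset.sum_subtype (p := fun x : n × n => R x.1 x.2) _ (by simp)]
  push_cast
  rfl

variable (u : n → ℤ)

def comp (w : ℤ) (m : Matrix n n F) : Matrix n n F :=
  Matrix.of fun i j => if u i - u j = w then m i j else 0

lemma comp_ad {A : Matrix n n F} {a : ℤ} (hA : ∀ i j, A i j ≠ 0 → u i - u j = a) (w : ℤ)
    (z : Matrix n n F) : comp u (w + a) (matAd F A z) = matAd F A (comp u w z) := by
  ext i j
  simp only [comp, matAd_apply, Matrix.of_apply, Matrix.sub_apply, Matrix.mul_apply]
  have e1 : ∀ k, A i k * (if u k - u j = w then z k j else 0) =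
      if u i - u j = w + a then A i k * z k j else 0 := by
    intro k
    by_cases h : A i k = 0
    · simp [h]
    · have := hA i k h
      by_cases h2 : u k - u j = w
      · rw [if_pos h2, if_pos (by omega)]
      · rw [if_neg h2, if_neg (by omega), mul_zero]
  have e2 : ∀ k, (if u i - u k = w then z i k else 0) * A k j =
      if u i - u j = w + a then z i k * A k j else 0 := by
    intro k
    by_cases h : A k j = 0
    · simp [h]
    · have := hA k j h
      by_cases h2 : u i - u k = w
      · rw [if_pos h2, if_pos (by omega)]
      · rw [if_neg h2, if_neg (by omega), zero_mul]
  simp only [e1, e2]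
  split_ifs <;> simp

lemma ad_diag (m : Matrix n n F) (i j : n) :
    (matAd F (Matrix.diagonal fun i => (u i : F)) m) i j = ((u i - u j : ℤ) : F) * m i j := by
  rw [matAd_apply, Matrix.sub_apply, Matrix.diagonal_mul, Matrix.mul_diagonal]
  push_cast; ring

lemma ad_diag_comp (w : ℤ) (m : Matrix n n F) :
    matAd F (Matrix.diagonal fun i => (u i : F)) (comp u w m) = (w : F) • comp u w m := by
  ext i j
  rw [ad_diag, Matrix.smul_apply, smul_eq_mul]
  simp only [comp, Matrix.of_apply]
  split_ifs with h
  · rw [h]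
  · simp

lemma shift_of_rel {A : Matrix n n F} {a : ℤ}
    (h : Matrix.diagonal (fun i => (u i : F)) * A - A * Matrix.diagonal (fun i => (u i : F)) =
      (a : F) • A) : ∀ i j, A i j ≠ 0 → u i - u j = a := by
  intro i j hne
  have := ad_diag u A i j
  rw [matAd_apply, h, Matrix.smul_apply, smul_eq_mul] at this
  have := mul_right_cancel₀ hne this
  exact_mod_cast this.symm

variable {e f : Matrix n n F}

lemma inj_FE (t : Tri (matAd F e) (matAd F (Matrix.diagonal fun i => (u i : F))) (matAd F f))
    (hf : IsNilpotent f) (se : ∀ i j, e i j ≠ 0 → u i - u j = 2)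
    (sf : ∀ i j, f i j ≠ 0 → u i - u j = -2) {z : Matrix n n F}
    (hz : matAd F f (matAd F e z) = 0) (i j : n) (hij : u i - u j ≤ -1) : z i j = 0 := by
  have h1 : comp u (u i - u j) z = 0 := by
    apply t.symm.eg_inj (matAd_nilp hf) (w := -(u i - u j)) (by omega)
    · rw [LinearMap.neg_apply, ad_diag_comp]; push_cast; module
    · rw [← comp_ad u se, ← comp_ad u sf, hz]
      ext; simp [comp]
  have := congrFun (congrFun h1 i) j
  simpa [comp] using this

lemma inj_F (t : Tri (matAd F e) (matAd F (Matrix.diagonal fun i => (u i : F))) (matAd F f))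
    (he : IsNilpotent e)
    (sf : ∀ i j, f i j ≠ 0 → u i - u j = -2) {z : Matrix n n F}
    (hz : matAd F f z = 0) (i j : n) (hij : 1 ≤ u i - u j) : z i j = 0 := by
  have h1 : comp u (u i - u j) z = 0 := by
    apply t.eg_inj (matAd_nilp he) (w := (u i - u j)) hij
    · rw [ad_diag_comp]
    · rw [← comp_ad u sf, hz]
      have : comp u (u i - u j + -2) (0 : Matrix n n F) = 0 := by ext; simp [comp]
      rw [this, map_zero]
  have := congrFun (congrFun h1 i) j
  simpa [comp] using this

end diag

section diag2
variable {F : Type*} [Field F] [CharZero F] {p : ℕ} (u : Fin p ⊕ Fin p → ℤ)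
  {e f : Matrix (Fin p ⊕ Fin p) (Fin p ⊕ Fin p) F}

/-- support condition: parity and weight -/
abbrev Sup (o : Prop) (P : ℤ → Prop) (i j : Fin p ⊕ Fin p) : Prop :=
  (Odd2 i j ↔ o) ∧ P (u i - u j)

lemma anti_iff (m : Matrix (Fin p ⊕ Fin p) (Fin p ⊕ Fin p) F) :
    m ∈ antiDiagBlock F p p ↔ ∀ i j, m i j ≠ 0 → Odd2 i j := by
  constructor
  · rintro ⟨h1, h2⟩ (i | i) (j | j) h
    · exact absurd (h1 i j) h
    · simp [Odd2]
    · simp [Odd2]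
    · exact absurd (h2 i j) h
  · intro h
    refine ⟨fun i j => ?_, fun i j => ?_⟩
    · by_contra hne
      have := h _ _ hne
      simp [Odd2] at this
    · by_contra hne
      have := h _ _ hne
      simp [Odd2] at this

lemma ad_supp {A : Matrix (Fin p ⊕ Fin p) (Fin p ⊕ Fin p) F} {a : ℤ}
    (hA : ∀ i j, A i j ≠ 0 → u i - u j = a) (hA' : ∀ i j, A i j ≠ 0 → Odd2 i j)
    {o o' : Prop} (ho : o' ↔ ¬ o) {P Q : ℤ → Prop} (hPQ : ∀ w, P w → Q (w + a))
    {z : Matrix (Fin p ⊕ Fin p) (Fin p ⊕ Fin p) F} (hz : z ∈ supp F (Sup u o P)) :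
    matAd F A z ∈ supp F (Sup u o' Q) := by
  have par1 : ∀ i k j : Fin p ⊕ Fin p, Odd2 i k → (Odd2 k j ↔ o) → (Odd2 i j ↔ o') := by
    intro i k j h1 h2
    rw [ho, ← h2]
    revert h1
    simp only [Odd2]
    cases i.isLeft <;> cases j.isLeft <;> cases k.isLeft <;> simp
  have par2 : ∀ i k j : Fin p ⊕ Fin p, Odd2 k j → (Odd2 i k ↔ o) → (Odd2 i j ↔ o') := by
    intro i k j h1 h2
    rw [ho, ← h2]
    revert h1
    simp only [Odd2]
    cases i.isLeft <;> cases j.isLeft <;> cases k.isLeft <;> simp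
  intro i j hij
  rw [matAd_apply, Matrix.sub_apply, Matrix.mul_apply, Matrix.mul_apply]
  rw [Finset.sum_eq_zero, Finset.sum_eq_zero, sub_zero]
  · intro k _
    by_contra hne
    have h1 := right_ne_zero_of_mul hne
    have h2 : Sup u o P i k := by
      by_contra h; exact left_ne_zero_of_mul hne (hz _ _ h)
    apply hij
    refine ⟨par2 i k j (hA' _ _ h1) h2.1, ?_⟩
    have := hPQ _ h2.2
    rwa [← hA _ _ h1, sub_add_sub_cancel] at this
  · intro k _
    by_contra hne
    have h1 := left_ne_zero_of_mul hne
    have h2 : Sup u o P k j := by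
      by_contra h; exact right_ne_zero_of_mul hne (hz _ _ h)
    apply hij
    refine ⟨par1 i k j (hA' _ _ h1) h2.1, ?_⟩
    have := hPQ _ h2.2
    rwa [← hA _ _ h1, add_comm, sub_add_sub_cancel] at this

lemma cnt_le (t : Tri (matAd F e) (matAd F (Matrix.diagonal fun i => (u i : F))) (matAd F f))
    (hf : IsNilpotent f) (se : ∀ i j, e i j ≠ 0 → u i - u j = 2)
    (sf : ∀ i j, f i j ≠ 0 → u i - u j = -2) (oe : ∀ i j, e i j ≠ 0 → Odd2 i j)
    (o o' : Prop) [Decidable o] [Decidable o'] (ho : o' ↔ ¬ o) (d : ℤ) (hd : -1 ≤ d) :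
    cnt u o (d + 2) ≤ cnt u o' d := by
  have hc : ∀ (o : Prop) [Decidable o] (d : ℤ), cnt u o d =
      (Module.finrank F (supp F (Sup u o (fun w => w = -d))) : ℤ) := by
    intro o _ d
    rw [finrank_supp, cnt]
    refine Finset.sum_congr rfl fun i _ => Finset.sum_congr rfl fun j _ => ?_
    have : ((Odd2 i j ↔ o) ∧ u j - u i = d) ↔ Sup u o (fun w => w = -d) i j :=
      and_congr_right fun _ => ⟨fun h => by omega, fun h => by omega⟩
    simp only [this]
  rw [hc, hc]
  have hm : ∀ z ∈ supp F (Sup u o (fun w => w = -(d + 2))),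
      matAd F e z ∈ supp F (Sup u o' (fun w => w = -d)) := fun z hz =>
    ad_supp u se oe ho (fun w hw => by omega) hz
  have inj : Function.Injective ((matAd F e).restrict hm) := by
    rw [← LinearMap.ker_eq_bot, LinearMap.ker_eq_bot']
    rintro ⟨z, hz⟩ h
    have h' : matAd F e z = 0 := congrArg Subtype.val h
    ext i j
    by_cases hij : Sup u o (fun w => w = -(d + 2)) i j
    · exact inj_FE u t hf se sf (by rw [h', map_zero]) i j (by have := hij.2; omega)
    · exact hz i j hij
  exact_mod_cast LinearMap.finrank_le_finrank_of_injective inj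

theorem diag_case (hp : 1 ≤ p) (he : e ∈ antiDiagBlock F p p)
    (hnil : IsNilpotent e) (hfnil : IsNilpotent f)
    (hf : f ∈ antiDiagBlock F p p)
    (h : Matrix (Fin p ⊕ Fin p) (Fin p ⊕ Fin p) F) (hh : h = Matrix.diagonal fun i => (u i : F))
    (rel1 : h * e - e * h = (2 : F) • e)
    (rel2 : h * f - f * h = (-2 : F) • f)
    (rel3 : e * f - f * e = h)
    (T : Module.End F ↥(antiDiagBlock F p p ⊓ LinearMap.ker (matAd F f)))
    (hT : ∀ m : ↥(antiDiagBlock F p p ⊓ LinearMap.ker (matAd F f)),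
      (T m : Matrix (Fin p ⊕ Fin p) (Fin p ⊕ Fin p) F)
        = (2 : F) • (m : Matrix (Fin p ⊕ Fin p) (Fin p ⊕ Fin p) F)
          - (h * (m : Matrix (Fin p ⊕ Fin p) (Fin p ⊕ Fin p) F)
            - (m : Matrix (Fin p ⊕ Fin p) (Fin p ⊕ Fin p) F) * h)) :
    ∃ k : ℤ, LinearMap.trace F _ T = (k : F) ∧
      2 * (p : ℤ) ^ 2 < k ∧ k ≤ 4 * (p : ℤ) ^ 2 := by
  have t := tri_ad rel1 rel2 rel3
  subst hh
  have se := shift_of_rel u (A := e) (a := 2) (by rw [rel1, Int.cast_ofNat])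
  have sf := shift_of_rel u (A := f) (a := -2) (by rw [rel2, Int.cast_neg, Int.cast_ofNat])
  have oe := (anti_iff e).mp he
  have of' := (anti_iff f).mp hf
  refine ⟨kval u, ?_, kval_lower u hp, kval_upper u
    (fun d hd => cnt_le u t hfnil se sf oe True False (by simp) d (by omega))
    (cnt_le u t hfnil se sf oe False True (by simp) (-1) le_rfl)⟩
  let R1 : Fin p ⊕ Fin p → Fin p ⊕ Fin p → Prop := Sup u True (fun w => w ≤ 0)
  let R0 : Fin p ⊕ Fin p → Fin p ⊕ Fin p → Prop := Sup u False (fun w => w ≤ -2)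
  have mf : ∀ z ∈ supp F R1, matAd F f z ∈ supp F R0 := fun z hz =>
    ad_supp u sf of' (by simp) (fun w hw => by omega) hz
  have me : ∀ z ∈ supp F R0, matAd F e z ∈ supp F R1 := fun z hz =>
    ad_supp u se oe (by simp) (fun w hw => by omega) hz
  have hKle : antiDiagBlock F p p ⊓ LinearMap.ker (matAd F f) ≤ supp F R1 := by
    rintro m ⟨hm1, hm2⟩ i j hij
    by_contra hne
    have ho := (anti_iff m).mp hm1 i j hne
    have : ¬ (u i - u j ≤ 0) := fun h => hij ⟨by simpa using ho, h⟩
    exact hne (inj_F u t hnil sf hm2 i j (by omega))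
  have mh : ∀ R : Fin p ⊕ Fin p → Fin p ⊕ Fin p → Prop, ∀ z ∈ supp F R,
      matAd F (Matrix.diagonal fun i => (u i : F)) z ∈ supp F R := by
    intro R z hz i j hij
    rw [ad_diag, hz i j hij, mul_zero]
  let H := matAd F (Matrix.diagonal fun i => (u i : F))
  let A : Module.End F (supp F R1) := (2 : F) • LinearMap.id - H.restrict (mh R1)
  let B : Module.End F (supp F R0) := - H.restrict (mh R0)
  let φ : supp F R1 →ₗ[F] supp F R0 := (matAd F f).restrict mf
  let ι := Submodule.inclusion hKle
  have hsurj : Function.Surjective φ := by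
    let ψ : supp F R0 →ₗ[F] supp F R1 := (matAd F e).restrict me
    have inj : Function.Injective (φ ∘ₗ ψ) := by
      rw [← LinearMap.ker_eq_bot, LinearMap.ker_eq_bot']
      rintro ⟨z, hz⟩ h
      have h' : matAd F f (matAd F e z) = 0 := congrArg Subtype.val h
      ext i j
      by_cases hij : R0 i j
      · exact inj_FE u t hfnil se sf h' i j (by have := hij.2; omega)
      · exact hz i j hij
    intro y
    obtain ⟨x, hx⟩ := LinearMap.injective_iff_surjective.mp inj y
    exact ⟨ψ x, hx⟩
  rw [trace_exact ι φ (Submodule.inclusion_injective hKle) hsurj ?_ T A B ?_ ?_]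
  · rw [trace_supp R1 A (fun i j => 2 - (u i - u j)) ?_, trace_supp R0 B (fun i j => -(u i - u j)) ?_,
      ← Int.cast_sub, kval]
    · congr 2
      · refine Finset.sum_congr rfl fun i _ => Finset.sum_congr rfl fun j _ => ?_
        refine if_congr (and_congr (by simp) (by constructor <;> intro <;> omega)) (by ring) rfl
      · refine Finset.sum_congr rfl fun i _ => Finset.sum_congr rfl fun j _ => ?_
        refine if_congr (and_congr (by simp) (by constructor <;> intro <;> omega)) (by ring) rfl
    · intro m i j
      have : (B m).1 i j = - (H m.1 i j) := rfl
      rw [this, ad_diag]; push_cast; ring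
    · intro m i j
      have : (A m).1 i j = 2 * m.1 i j - (H m.1 i j) := rfl
      rw [this, ad_diag]; push_cast; ring
  · intro x
    constructor
    · intro hx
      have hx' : matAd F f x.1 = 0 := congrArg Subtype.val hx
      refine ⟨⟨x.1, (anti_iff _).mpr fun i j hne => ?_, hx'⟩, rfl⟩
      refine Classical.byContradiction fun ho => ?_
      exact hne (x.2 i j (fun h => ho (by simpa using h.1)))
    · rintro ⟨y, rfl⟩
      exact Subtype.ext y.2.2
  · intro x
    exact Subtype.ext (hT x)
  · intro x
    apply Subtype.ext
    have e1 : (φ (A x)).1 = matAd F f ((2 : F) • x.1 - H x.1) := rfl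
    have e2 : (B (φ x)).1 = - H (matAd F f x.1) := rfl
    rw [e1, e2, t.hG, map_sub, map_smul]
    abel

end diag2
end Sl2Aux
namespace Sl2Aux
set_option linter.unusedSectionVars false

section red
variable {F : Type*} [Field F] [CharZero F]

lemma f_nilp {n : Type*} [Fintype n] [DecidableEq n] {h f : Matrix n n F}
    (rel2 : h * f - f * h = (-2 : F) • f) : IsNilpotent f := by
  have key : ∀ k : ℕ, h * f ^ k - f ^ k * h = (-(2 * (k : F))) • f ^ k := by
    intro k
    induction k with
    | zero => simp
    | succ k ih =>
      have : h * f ^ (k + 1) - f ^ (k + 1) * h =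
          (h * f ^ k - f ^ k * h) * f + f ^ k * (h * f - f * h) := by
        rw [pow_succ]; noncomm_ring
      rw [this, ih, rel2, Matrix.smul_mul, Matrix.mul_smul, ← pow_succ, ← add_smul]
      congr 1
      push_cast; ring
  by_contra hn
  have hne : ∀ k, f ^ k ≠ 0 := fun k hk => hn ⟨k, hk⟩
  have hev : ∀ k : ℕ, Module.End.HasEigenvalue (matAd F h) (-(2 * (k : F))) := fun k =>
    Module.End.hasEigenvalue_of_hasEigenvector
      (Module.End.hasEigenvector_iff.mpr ⟨Module.End.mem_eigenspace_iff.mpr (key k), hne k⟩)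
  have hfin := Module.End.finite_hasEigenvalue (matAd F h)
  refine Set.infinite_of_injective_forall_mem (f := fun k : ℕ => -(2 * (k : F))) ?_ hev hfin
  intro a b hab
  simpa using hab

lemma exists_diag {p : ℕ} (M : Matrix (Fin p) (Fin p) F)
    (hs : ∀ x, x ∈ Submodule.span F {x : Fin p → F | ∃ k : ℤ, M *ᵥ x = (k : F) • x}) :
    ∃ (g g' : Matrix (Fin p) (Fin p) F) (u : Fin p → ℤ), g * g' = 1 ∧ g' * g = 1 ∧
      M * g = g * Matrix.diagonal fun i => (u i : F) := by
  let b0 := Module.Basis.ofSpan (K := F) (s := {x : Fin p → F | ∃ k : ℤ, M *ᵥ x = (k : F) • x})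
    (fun x _ => hs x)
  have hb0 : ∀ i, ∃ k : ℤ, M *ᵥ (b0 i) = (k : F) • b0 i := fun i =>
    Module.Basis.ofSpan_subset (K := F)
      (s := {x : Fin p → F | ∃ k : ℤ, M *ᵥ x = (k : F) • x}) (fun x _ => hs x) ⟨i, rfl⟩
  haveI : Fintype _ := Module.Basis.fintypeIndexOfRankLtAleph0 b0 (Module.rank_lt_aleph0 F _)
  have hc := Module.finrank_eq_card_basis b0
  rw [Module.finrank_fin_fun] at hc
  let b := b0.reindex (Fintype.equivFinOfCardEq hc.symm)
  have hb : ∀ i, ∃ k : ℤ, M *ᵥ (b i) = (k : F) • b i := fun i => by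
    simp only [b, Module.Basis.reindex_apply]; exact hb0 _
  choose u hu using hb
  refine ⟨(Pi.basisFun F (Fin p)).toMatrix b, b.toMatrix (Pi.basisFun F (Fin p)), u,
    Module.Basis.toMatrix_mul_toMatrix_flip _ _, Module.Basis.toMatrix_mul_toMatrix_flip _ _, ?_⟩
  ext i j
  rw [Matrix.mul_diagonal]
  have := congrFun (hu j) i
  simp only [Pi.smul_apply, smul_eq_mul] at this
  rw [Module.Basis.toMatrix_apply, Pi.basisFun_repr, mul_comm, ← this]
  simp [Matrix.mul_apply, Matrix.mulVec, dotProduct, Module.Basis.toMatrix_apply]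

lemma tri_vec {n : Type*} [Fintype n] [DecidableEq n] {e h f : Matrix n n F}
    (rel1 : h * e - e * h = (2 : F) • e)
    (rel2 : h * f - f * h = (-2 : F) • f) (rel3 : e * f - f * e = h) :
    Tri (Matrix.toLin' e) (Matrix.toLin' h) (Matrix.toLin' f) where
  hE x := by
    simp only [Matrix.toLin'_apply, Matrix.mulVec_mulVec]
    rw [← Matrix.smul_mulVec, ← rel1, ← Matrix.add_mulVec]; congr 1; abel
  hG x := by
    simp only [Matrix.toLin'_apply, Matrix.mulVec_mulVec]
    rw [← Matrix.smul_mulVec, ← Matrix.sub_mulVec]; congr 1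
    rw [sub_eq_add_neg, ← neg_smul, ← rel2]; abel
  hEG x := by
    simp only [Matrix.toLin'_apply, Matrix.mulVec_mulVec]
    rw [← rel3, ← Matrix.add_mulVec]; congr 1; abel

lemma toLin_nilp {n : Type*} [Fintype n] [DecidableEq n] {e : Matrix n n F}
    (he : IsNilpotent e) : IsNilpotent (Matrix.toLin' e) := by
  obtain ⟨k, hk⟩ := he
  exact ⟨k, by rw [← Matrix.toLin'_pow, hk, map_zero]⟩

/-- block form -/
lemma anti_blocks {p : ℕ} {m : Matrix (Fin p ⊕ Fin p) (Fin p ⊕ Fin p) F} :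
    m ∈ antiDiagBlock F p p ↔ ∃ B C, m = Matrix.fromBlocks 0 B C 0 := by
  constructor
  · rintro ⟨h1, h2⟩
    refine ⟨m.toBlocks₁₂, m.toBlocks₂₁, ?_⟩
    ext (i | i) (j | j)
    · simpa using h1 i j
    · rfl
    · rfl
    · simpa using h2 i j
  · rintro ⟨B, C, rfl⟩
    exact ⟨fun i j => rfl, fun i j => rfl⟩

lemma exists_conj {p : ℕ} {e h f : Matrix (Fin p ⊕ Fin p) (Fin p ⊕ Fin p) F}
    (hnil : IsNilpotent e)
    (hh : ∀ i j, h (Sum.inl i) (Sum.inr j) = 0)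
    (hh' : ∀ i j, h (Sum.inr i) (Sum.inl j) = 0)
    (rel1 : h * e - e * h = (2 : F) • e)
    (rel2 : h * f - f * h = (-2 : F) • f)
    (rel3 : e * f - f * e = h) :
    ∃ (g g' : Matrix (Fin p ⊕ Fin p) (Fin p ⊕ Fin p) F) (u : Fin p ⊕ Fin p → ℤ),
      g * g' = 1 ∧ g' * g = 1 ∧ h * g = g * (Matrix.diagonal fun i => (u i : F)) ∧
      (∀ m ∈ antiDiagBlock F p p, g' * m * g ∈ antiDiagBlock F p p) ∧
      (∀ m ∈ antiDiagBlock F p p, g * m * g' ∈ antiDiagBlock F p p) := by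
  have hsp := (tri_vec rel1 rel2 rel3).span_eig (toLin_nilp hnil) (toLin_nilp (f_nilp rel2))
  have hb : h = Matrix.fromBlocks h.toBlocks₁₁ 0 0 h.toBlocks₂₂ := by
    ext (i | i) (j | j)
    · rfl
    · simpa using hh i j
    · simpa using hh' i j
    · rfl
  obtain ⟨g0, g0', u0, a1, a2, a3⟩ := exists_diag h.toBlocks₁₁ (by
    intro y
    have hy : Sum.elim y (0 : Fin p → F) ∈ Submodule.span F
      {x | ∃ k : ℤ, Matrix.toLin' h x = (k : F) • x} := hsp ▸ Submodule.mem_top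
    have := Submodule.mem_map_of_mem (f := LinearMap.funLeft F F (Sum.inl : Fin p → Fin p ⊕ Fin p)) hy
    rw [Submodule.map_span] at this
    refine Submodule.span_mono ?_ this
    rintro _ ⟨x, ⟨k, hk⟩, rfl⟩
    refine ⟨k, ?_⟩
    ext i
    have := congrFun hk (Sum.inl i)
    rw [Matrix.toLin'_apply, hb] at this
    simpa [Matrix.mulVec, dotProduct, LinearMap.funLeft_apply] using this)
  obtain ⟨g1, g1', u1, b1, b2, b3⟩ := exists_diag h.toBlocks₂₂ (by
    intro y
    have hy : Sum.elim (0 : Fin p → F) y ∈ Submodule.span F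
      {x | ∃ k : ℤ, Matrix.toLin' h x = (k : F) • x} := hsp ▸ Submodule.mem_top
    have := Submodule.mem_map_of_mem (f := LinearMap.funLeft F F (Sum.inr : Fin p → Fin p ⊕ Fin p)) hy
    rw [Submodule.map_span] at this
    refine Submodule.span_mono ?_ this
    rintro _ ⟨x, ⟨k, hk⟩, rfl⟩
    refine ⟨k, ?_⟩
    ext i
    have := congrFun hk (Sum.inr i)
    rw [Matrix.toLin'_apply, hb] at this
    simpa [Matrix.mulVec, dotProduct, LinearMap.funLeft_apply] using this)
  have hd : (Matrix.diagonal fun i => ((Sum.elim u0 u1 i : ℤ) : F)) =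
      Matrix.fromBlocks (Matrix.diagonal fun i => (u0 i : F)) 0 0
        (Matrix.diagonal fun i => (u1 i : F)) := by
    rw [Matrix.fromBlocks_diagonal]
    congr 1
    ext (i | i) <;> rfl
  refine ⟨Matrix.fromBlocks g0 0 0 g1, Matrix.fromBlocks g0' 0 0 g1', Sum.elim u0 u1, ?_, ?_, ?_, ?_, ?_⟩
  · simp [Matrix.fromBlocks_multiply, a1, b1]
  · simp [Matrix.fromBlocks_multiply, a2, b2]
  · rw [hd, hb, Matrix.fromBlocks_multiply, Matrix.fromBlocks_multiply]
    simp only [Matrix.toBlocks_fromBlocks₁₁, Matrix.toBlocks_fromBlocks₂₂, a3, b3,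
      Matrix.mul_zero, Matrix.zero_mul, add_zero, zero_add]
  · intro m hm
    obtain ⟨B, C, rfl⟩ := anti_blocks.mp hm
    refine anti_blocks.mpr ⟨g0' * B * g1, g1' * C * g0, ?_⟩
    simp [Matrix.fromBlocks_multiply]
  · intro m hm
    obtain ⟨B, C, rfl⟩ := anti_blocks.mp hm
    refine anti_blocks.mpr ⟨g0 * B * g1', g1 * C * g0', ?_⟩
    simp [Matrix.fromBlocks_multiply]

/-- conjugation -/
def cj {n : Type*} [Fintype n] (g' g : Matrix n n F) : Matrix n n F →ₗ[F] Matrix n n F where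
  toFun m := g' * m * g
  map_add' a b := by rw [Matrix.mul_add, Matrix.add_mul]
  map_smul' c a := by simp

section cjlem
variable {n : Type*} [Fintype n] [DecidableEq n] {g g' : Matrix n n F}

lemma cj_mul (hg : g * g' = 1) (a b : Matrix n n F) : cj g' g (a * b) = cj g' g a * cj g' g b := by
  change g' * (a * b) * g = (g' * a * g) * (g' * b * g)
  calc g' * (a * b) * g = g' * a * 1 * (b * g) := by noncomm_ring
    _ = _ := by rw [← hg]; noncomm_ring

lemma cj_cj (hg : g * g' = 1) (a : Matrix n n F) : cj g g' (cj g' g a) = a := by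
  change g * (g' * a * g) * g' = a
  calc g * (g' * a * g) * g' = (g * g') * a * (g * g') := by noncomm_ring
    _ = _ := by rw [hg]; simp

lemma cj_pow (hg : g * g' = 1) (hg' : g' * g = 1) (a : Matrix n n F) (k : ℕ) :
    cj g' g (a ^ k) = cj g' g a ^ k := by
  induction k with
  | zero => rw [pow_zero, pow_zero]; change g' * 1 * g = 1; rw [mul_one, hg']
  | succ k ih => rw [pow_succ, cj_mul hg, ih, pow_succ]

lemma cj_nilp (hg : g * g' = 1) (hg' : g' * g = 1) {a : Matrix n n F} (ha : IsNilpotent a) :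
    IsNilpotent (cj g' g a) := by
  obtain ⟨k, hk⟩ := ha
  exact ⟨k, by rw [← cj_pow hg hg', hk, map_zero]⟩

lemma cj_ad (hg : g * g' = 1) (a b : Matrix n n F) :
    cj g' g (a * b - b * a) = cj g' g a * cj g' g b - cj g' g b * cj g' g a := by
  rw [map_sub, cj_mul hg, cj_mul hg]

end cjlem

theorem main_case (p : ℕ) (hp : 1 ≤ p)
    (e h f : Matrix (Fin p ⊕ Fin p) (Fin p ⊕ Fin p) F)
    (he : e ∈ antiDiagBlock F p p)
    (hnil : IsNilpotent e)
    (hh : ∀ i j, h (Sum.inl i) (Sum.inr j) = 0)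
    (hh' : ∀ i j, h (Sum.inr i) (Sum.inl j) = 0)
    (hf : f ∈ antiDiagBlock F p p)
    (rel1 : h * e - e * h = (2 : F) • e)
    (rel2 : h * f - f * h = (-2 : F) • f)
    (rel3 : e * f - f * e = h)
    (T : Module.End F ↥(antiDiagBlock F p p ⊓ LinearMap.ker (matAd F f)))
    (hT : ∀ m : ↥(antiDiagBlock F p p ⊓ LinearMap.ker (matAd F f)),
      (T m : Matrix (Fin p ⊕ Fin p) (Fin p ⊕ Fin p) F)
        = (2 : F) • (m : Matrix (Fin p ⊕ Fin p) (Fin p ⊕ Fin p) F)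
          - (h * (m : Matrix (Fin p ⊕ Fin p) (Fin p ⊕ Fin p) F)
            - (m : Matrix (Fin p ⊕ Fin p) (Fin p ⊕ Fin p) F) * h)) :
    ∃ k : ℤ, LinearMap.trace F _ T = (k : F) ∧
      2 * (p : ℤ) ^ 2 < k ∧ k ≤ 4 * (p : ℤ) ^ 2 := by
  obtain ⟨g, g', u, hg, hg', hu, s1, s2⟩ := exists_conj hnil hh hh' rel1 rel2 rel3
  have m1 : ∀ m ∈ antiDiagBlock F p p ⊓ LinearMap.ker (matAd F f),
      cj g' g m ∈ antiDiagBlock F p p ⊓ LinearMap.ker (matAd F (cj g' g f)) := by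
    rintro m ⟨hm, hk⟩
    refine ⟨s1 m hm, ?_⟩
    have hk' : f * m - m * f = 0 := hk
    change cj g' g f * cj g' g m - cj g' g m * cj g' g f = 0
    rw [← cj_ad hg, hk', map_zero]
  have m2 : ∀ m ∈ antiDiagBlock F p p ⊓ LinearMap.ker (matAd F (cj g' g f)),
      cj g g' m ∈ antiDiagBlock F p p ⊓ LinearMap.ker (matAd F f) := by
    rintro m ⟨hm, hk⟩
    refine ⟨s2 m hm, ?_⟩
    have hk' : cj g' g f * m - m * cj g' g f = 0 := hk
    have := cj_ad hg' (cj g' g f) m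
    rw [hk', map_zero, cj_cj hg] at this
    exact this.symm
  let E : ↥(antiDiagBlock F p p ⊓ LinearMap.ker (matAd F f)) ≃ₗ[F]
      ↥(antiDiagBlock F p p ⊓ LinearMap.ker (matAd F (cj g' g f))) :=
    LinearEquiv.ofLinearMap ((cj g' g).restrict m1) ((cj g g').restrict m2)
      (by ext1 x; exact Subtype.ext (cj_cj hg' x.1))
      (by ext1 x; exact Subtype.ext (cj_cj hg x.1))
  have hdiag : cj g' g h = Matrix.diagonal fun i => (u i : F) := by
    change g' * h * g = _
    rw [Matrix.mul_assoc, hu, ← Matrix.mul_assoc, hg', Matrix.one_mul]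
  have := diag_case u hp (s1 e he) (cj_nilp hg hg' hnil) (cj_nilp hg hg' (f_nilp rel2)) (s1 f hf)
    (cj g' g h) hdiag
    (by change cj g' g h * cj g' g e - cj g' g e * cj g' g h = (2 : F) • cj g' g e
        rw [← cj_ad hg, rel1, map_smul])
    (by rw [← cj_ad hg, rel2, map_smul])
    (by change cj g' g e * cj g' g f - cj g' g f * cj g' g e = cj g' g h
        rw [← cj_ad hg, rel3])
    (E.conj T) (by
      intro m
      have e1 : ((E.conj T) m).1 = cj g' g (T (E.symm m)).1 := rfl
      have e2 : cj g' g (E.symm m).1 = m.1 := cj_cj hg' m.1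
      rw [e1, hT, map_sub, map_smul, cj_ad hg, e2])
  rwa [LinearMap.trace_conj'] at this

end red
end Sl2Aux

/-- for any graded sl₂-triple `{h, e, f}` with `e ∈ I_{p,p}` nilpotent,
the (integer) trace of `2 − ad h` on `I_{p,p}^f = I_{p,p} ∩ ker(ad f)` satisfies
`2p² < tr(2 − h)|_{I_{p,p}^f} ≤ 4p²`. -/
theorem stmt_8 (F : Type*) [Field F] [CharZero F] (p : ℕ) (hp : 1 ≤ p)
    (e h f : Matrix (Fin p ⊕ Fin p) (Fin p ⊕ Fin p) F)
    (he : e ∈ antiDiagBlock F p p)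
    (hnil : IsNilpotent e)
    (hh : ∀ i j, h (Sum.inl i) (Sum.inr j) = 0)
    (hh' : ∀ i j, h (Sum.inr i) (Sum.inl j) = 0)
    (hf : f ∈ antiDiagBlock F p p)
    (rel1 : h * e - e * h = (2 : F) • e)
    (rel2 : h * f - f * h = (-2 : F) • f)
    (rel3 : e * f - f * e = h)
    (T : Module.End F ↥(antiDiagBlock F p p ⊓ LinearMap.ker (matAd F f)))
    (hT : ∀ m : ↥(antiDiagBlock F p p ⊓ LinearMap.ker (matAd F f)),
      (T m : Matrix (Fin p ⊕ Fin p) (Fin p ⊕ Fin p) F)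
        = (2 : F) • (m : Matrix (Fin p ⊕ Fin p) (Fin p ⊕ Fin p) F)
          - (h * (m : Matrix (Fin p ⊕ Fin p) (Fin p ⊕ Fin p) F)
            - (m : Matrix (Fin p ⊕ Fin p) (Fin p ⊕ Fin p) F) * h)) :
    ∃ k : ℤ, LinearMap.trace F _ T = (k : F) ∧
      2 * (p : ℤ) ^ 2 < k ∧ k ≤ 4 * (p : ℤ) ^ 2 := by
  exact Sl2Aux.main_case p hp e h f he hnil hh hh' hf rel1 rel2 rel3 T hT
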